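/- arXiv:1903.01099 — 2 statements merged into one kernel-verified Lean document; each statement's English description precedes it below -/
import Mathlib

section
/- There exists a family of two-variable integer polynomials C : ℕ × ℕ → ℤ[x,y] with C(0,0) = 1 which simultaneously satisfies, for all k, l ≥ 0 (with the convention that any term whose index would be negative is omitted/zero): x·C(k,l) = C(k+1,l) + C(k−1,l+1) + C(k,l−1), and y·C(k,l) = C(k,l+1) + C(k+1,l−1) + C(k−1,l). (This overdetermined system is consistent; its solution is the family of A₂ Chebyshev polynomials of the second kind.) -/
open MvPolynomial

/-- A family `C : ℕ × ℕ → ℤ[x,y]` is a family of A₂ Chebyshev polynomials of the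
second kind if `C (0,0) = 1` and it satisfies the two recursions
`x·C(k,l) = C(k+1,l) + C(k−1,l+1) + C(k,l−1)` and
`y·C(k,l) = C(k,l+1) + C(k+1,l−1) + C(k−1,l)`, where any term whose index would be
negative is omitted (i.e. is zero). -/
def IsA2Chebyshev (C : ℕ × ℕ → MvPolynomial (Fin 2) ℤ) : Prop :=
  C (0, 0) = 1 ∧
  (∀ k l : ℕ, (X 0 : MvPolynomial (Fin 2) ℤ) * C (k, l) =
      C (k + 1, l) + (if k = 0 then 0 else C (k - 1, l + 1)) +
        (if l = 0 then 0 else C (k, l - 1))) ∧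
  (∀ k l : ℕ, (X 1 : MvPolynomial (Fin 2) ℤ) * C (k, l) =
      C (k, l + 1) + (if l = 0 then 0 else C (k + 1, l - 1)) +
        (if k = 0 then 0 else C (k - 1, l)))

/-- The complete homogeneous symmetric polynomials in three variables with elementary symmetric
polynomials `a`, `b`, `1`, shifted by two so that the terms of index `-2` and `-1` are included. -/
def shiftedHomogeneous {R : Type*} [CommRing R] (a b : R) : ℕ → R
  | 0 => 0
  | 1 => 0
  | 2 => 1
  | n + 3 => a * shiftedHomogeneous a b (n + 2) - b * shiftedHomogeneous a b (n + 1) +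
      shiftedHomogeneous a b n

theorem shiftedHomogeneous_add_three {R : Type*} [CommRing R] (a b : R) (n : ℕ) :
    shiftedHomogeneous a b (n + 3) = a * shiftedHomogeneous a b (n + 2) -
      b * shiftedHomogeneous a b (n + 1) + shiftedHomogeneous a b n := by
  rw [shiftedHomogeneous]

/-- There exists a family of A₂ Chebyshev polynomials of the second kind. -/
theorem exists_A2Chebyshev : ∃ C : ℕ × ℕ → MvPolynomial (Fin 2) ℤ, IsA2Chebyshev C := by
  let h := shiftedHomogeneous (X 0 : MvPolynomial (Fin 2) ℤ) (X 1)
  let g := shiftedHomogeneous (X 1 : MvPolynomial (Fin 2) ℤ) (X 0)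
  have h_rec (n : ℕ) : h (n + 3) = X 0 * h (n + 2) - X 1 * h (n + 1) + h n :=
    shiftedHomogeneous_add_three _ _ n
  have g_rec (n : ℕ) : g (n + 3) = X 1 * g (n + 2) - X 0 * g (n + 1) + g n :=
    shiftedHomogeneous_add_three _ _ n
  have h_zero : h 0 = 0 := by simp [h, shiftedHomogeneous]
  have h_one : h 1 = 0 := by simp [h, shiftedHomogeneous]
  have g_zero : g 0 = 0 := by simp [g, shiftedHomogeneous]
  have g_one : g 1 = 0 := by simp [g, shiftedHomogeneous]
  let C : ℕ × ℕ → MvPolynomial (Fin 2) ℤ := fun p =>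
    h (p.1 + 2) * g (p.2 + 2) - h (p.1 + 1) * g (p.2 + 1)
  have pred_left (k l : ℕ) : (if k = 0 then 0 else C (k - 1, l)) =
      h (k + 1) * g (l + 2) - h k * g (l + 1) := by
    cases k <;> simp [C, h_zero, h_one]
  have pred_right (k l : ℕ) : (if l = 0 then 0 else C (k, l - 1)) =
      h (k + 2) * g (l + 1) - h (k + 1) * g l := by
    cases l <;> simp [C, g_zero, g_one]
  refine ⟨C, by simp [C, h, g, shiftedHomogeneous], fun k l => ?_, fun k l => ?_⟩
  · rw [pred_left, pred_right]
    linear_combination -g (l + 2) * h_rec k - h (k + 1) * g_rec l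
  · rw [pred_left, pred_right]
    linear_combination -h (k + 2) * g_rec l - g (l + 1) * h_rec k
end

section
/- Any family C : ℕ × ℕ → ℤ[x,y] with C(0,0) = 1 satisfying, for all k, l ≥ 0 (terms with a negative index omitted), x·C(k,l) = C(k+1,l) + C(k−1,l+1) + C(k,l−1) and y·C(k,l) = C(k,l+1) + C(k+1,l−1) + C(k−1,l), is symmetric under simultaneous exchange of the indices and the variables: for all k, l, the polynomial C(l,k) equals the image of C(k,l) under the ring automorphism of ℤ[x,y] swapping x and y. -/
open MvPolynomial

/-- There is at most one family of A₂ Chebyshev polynomials of the second kind. -/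
theorem IsA2Chebyshev.unique {C D : ℕ × ℕ → MvPolynomial (Fin 2) ℤ}
    (hC : IsA2Chebyshev C) (hD : IsA2Chebyshev D) : C = D := by
  obtain ⟨hC0, hCx, hCy⟩ := hC
  obtain ⟨hD0, hDx, hDy⟩ := hD
  suffices h : ∀ n k l, k + l = n → C (k, l) = D (k, l) from
    funext fun ⟨k, l⟩ => h _ k l rfl
  intro n
  induction n using Nat.strong_induction_on with
  | _ n ih =>
    have ih' : ∀ k l, k + l < n → C (k, l) = D (k, l) := fun k l h => ih _ h k l rfl
    rintro (_ | k) l hn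
    · rcases l with _ | l
      · rw [hC0, hD0]
      · have hc := hCy 0 l
        have hd := hDy 0 l
        rw [ih' 0 l (by omega), hd] at hc
        rcases l with _ | l
        · simpa using hc.symm
        · simpa [ih' 1 l (by omega)] using hc.symm
    · have hc := hCx k l
      have hd := hDx k l
      rw [ih' k l (by omega), hd] at hc
      rcases k with _ | k <;> rcases l with _ | l
      · simpa using hc.symm
      · simpa [ih' 0 l (by omega)] using hc.symm
      · simpa [ih' k 1 (by omega)] using hc.symm
      · simpa [ih' k (l + 1 + 1) (by omega), ih' (k + 1) l (by omega)] using hc.symm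

/-- Exchanging the indices and swapping the variables preserves the defining recursions. -/
theorem IsA2Chebyshev.rename_swap {C : ℕ × ℕ → MvPolynomial (Fin 2) ℤ}
    (hC : IsA2Chebyshev C) :
    IsA2Chebyshev fun p => rename (Equiv.swap (0 : Fin 2) 1) (C p.swap) := by
  obtain ⟨h0, hx, hy⟩ := hC
  refine ⟨by simp [h0], fun k l => ?_, fun k l => ?_⟩
  · simpa [apply_ite (rename (Equiv.swap (0 : Fin 2) 1))] using
      congrArg (rename (Equiv.swap (0 : Fin 2) 1)) (hy l k)
  · simpa [apply_ite (rename (Equiv.swap (0 : Fin 2) 1))] using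
      congrArg (rename (Equiv.swap (0 : Fin 2) 1)) (hx l k)

/-- The A₂ Chebyshev polynomials are symmetric under simultaneously exchanging the
indices and swapping the two variables. -/
theorem A2Chebyshev_symm (C : ℕ × ℕ → MvPolynomial (Fin 2) ℤ) (hC : IsA2Chebyshev C) :
    ∀ k l : ℕ, C (l, k) = rename (Equiv.swap (0 : Fin 2) 1) (C (k, l)) := by
  intro k l
  exact congrFun (hC.unique hC.rename_swap) (l, k)
end
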